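/- There exist absolute constants c > 0 and C ≥ 1 such that for all integers k and n with k ≥ C and n ≥ C·k: any length-n ROBP over alphabet [k] that computes ApproxCount_k[n, n/k] has width w satisfying log₂ w ≥ c · k · log₂(n/k). -/

import Mathlib

open Finset

/-- A length-`n` read-once branching program over alphabet `σ` with outputs in `Out`.
Layer `t` has vertex set `Fin (size t)` (only layers `0, 1, …, n` are relevant);
layer `0` consists of a single start vertex, and each vertex of layer `t` has an
outgoing edge to layer `t+1` for every letter of the alphabet. -/
structure ROBP (σ Out : Type) (n : ℕ) where
  size : ℕ → ℕ
  size0 : size 0 = 1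
  sizePos : ∀ t, 0 < size t
  step : (t : ℕ) → Fin (size t) → σ → Fin (size (t + 1))
  out : Fin (size n) → Out

namespace ROBP

variable {σ Out : Type} {n : ℕ}

/-- The vertex reached in layer `t` on input `x` (only `x 0, …, x (t-1)` matter). -/
def state (P : ROBP σ Out n) (x : ℕ → σ) : (t : ℕ) → Fin (P.size t)
  | 0 => ⟨0, P.sizePos 0⟩
  | t + 1 => P.step t (state P x t) (x t)

/-- The width of an ROBP: the maximal number of vertices in a single layer. -/
def width (P : ROBP σ Out n) : ℕ := (Finset.range (n + 1)).sup P.size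

/-- Every vertex (in the relevant layers) is reached by some input: no useless vertices. -/
def Reachable (P : ROBP σ Out n) : Prop :=
  ∀ t, t ≤ n → ∀ v : Fin (P.size t), ∃ x : ℕ → σ, P.state x t = v

/-- The output of the program on input `x`. -/
def eval (P : ROBP σ Out n) (x : ℕ → σ) : Out := P.out (P.state x n)

end ROBP

/-- The number of occurrences of `j` among `x 0, …, x (t-1)`. -/
def countK {k : ℕ} (x : ℕ → Fin k) (t : ℕ) (j : Fin k) : ℕ :=
  ((Finset.range t).filter fun i => x i = j).card

/-- `P` computes `ApproxCount_k[n, Δ]`: on every input, each of the `k` outputs estimates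
the frequency of the corresponding letter within additive error `Δ`. -/
def ComputesApproxCountK (k n : ℕ) (Δ : ℝ) (P : ROBP (Fin k) (Fin k → ℝ) n) : Prop :=
  ∀ x : ℕ → Fin k, ∀ j : Fin k, |P.eval x j - (countK x n j : ℝ)| ≤ Δ

/-- `P` computes `ApproxCount[n, Δ]` (the `{0,1}` case). -/
def ComputesApproxCount (n : ℕ) (Δ : ℝ) (P : ROBP Bool ℝ n) : Prop :=
  ∀ x : ℕ → Bool, |P.eval x - (((Finset.range n).filter fun i => x i = true).card : ℝ)| ≤ Δ

/-- The number of `1`'s in coordinate `j` among `x 0, …, x (t-1)`. -/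
def countPar {k : ℕ} (x : ℕ → (Fin k → Bool)) (t : ℕ) (j : Fin k) : ℕ :=
  ((Finset.range t).filter fun i => x i j = true).card

/-- `P` computes `ApproxCount^par_k[n, Δ]`. -/
def ComputesApproxCountPar (k n : ℕ) (Δ : ℝ) (P : ROBP (Fin k → Bool) (Fin k → ℝ) n) : Prop :=
  ∀ x : ℕ → (Fin k → Bool), ∀ j : Fin k, |P.eval x j - (countPar x n j : ℝ)| ≤ Δ

/-- The inclusion `[k-1] ⊆ [k]`. -/
def idx {k : ℕ} (j : Fin (k - 1)) : Fin k := Fin.castLE (Nat.sub_le k 1) j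

/-- `a_j(v)`: the minimal possible number of `j`'s in the first `t` input words
reaching the vertex `v` of layer `t`. -/
noncomputable def rectLo {k n : ℕ} (P : ROBP (Fin k) (Fin k → ℝ) n) (t : ℕ)
    (v : Fin (P.size t)) (j : Fin (k - 1)) : ℕ :=
  sInf {c | ∃ x : ℕ → Fin k, P.state x t = v ∧ countK x t (idx j) = c}

/-- `b_j(v)`: the maximal possible number of `j`'s in the first `t` input words
reaching the vertex `v` of layer `t`. -/
noncomputable def rectHi {k n : ℕ} (P : ROBP (Fin k) (Fin k → ℝ) n) (t : ℕ)
    (v : Fin (P.size t)) (j : Fin (k - 1)) : ℕ :=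
  sSup {c | ∃ x : ℕ → Fin k, P.state x t = v ∧ countK x t (idx j) = c}

/-- `a_j(v)` for the `k`-parallel case. -/
noncomputable def parLo {k n : ℕ} (P : ROBP (Fin k → Bool) (Fin k → ℝ) n) (t : ℕ)
    (v : Fin (P.size t)) (j : Fin k) : ℕ :=
  sInf {c | ∃ x : ℕ → (Fin k → Bool), P.state x t = v ∧ countPar x t j = c}

/-- `b_j(v)` for the `k`-parallel case. -/
noncomputable def parHi {k n : ℕ} (P : ROBP (Fin k → Bool) (Fin k → ℝ) n) (t : ℕ)
    (v : Fin (P.size t)) (j : Fin k) : ℕ :=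
  sSup {c | ∃ x : ℕ → (Fin k → Bool), P.state x t = v ∧ countPar x t j = c}

/-- The axis-parallel box `[lo 1, hi 1] × ⋯ × [lo m, hi m]` (as a set of integer points). -/
def rect {m : ℕ} (lo hi : Fin m → ℕ) : Set (Fin m → ℕ) :=
  {y | ∀ j, lo j ≤ y j ∧ y j ≤ hi j}

/-- The potential `φ_t(x)` of the point `x` (k-counter case): the maximum, over all
rectangle labels of layer `t` containing `x`, of `min{Σ_j b_j, t} - Σ_j x_j`. -/
noncomputable def phiK {k n : ℕ} (P : ROBP (Fin k) (Fin k → ℝ) n) (t : ℕ)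
    (x : Fin (k - 1) → ℕ) : ℕ :=
  Finset.univ.sup fun v : Fin (P.size t) =>
    if ∀ j, rectLo P t v j ≤ x j ∧ x j ≤ rectHi P t v j then
      min (∑ j, rectHi P t v j) t - ∑ j, x j
    else 0

/-- `T_{t,k}`: tuples of naturals summing to at most `t`. -/
def Tset (k t : ℕ) : Finset (Fin (k - 1) → ℕ) :=
  (Fintype.piFinset fun _ => Finset.range (t + 1)).filter fun x => ∑ j, x j ≤ t

/-- The total potential `Φ_t` of layer `t` (k-counter case). -/
noncomputable def PhiK {k n : ℕ} (P : ROBP (Fin k) (Fin k → ℝ) n) (t : ℕ) : ℕ :=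
  ∑ x ∈ Tset k t, phiK P t x

/-- The potential `φ_t(x)` of the point `x` (k-parallel case). -/
noncomputable def phiPar {k n : ℕ} (P : ROBP (Fin k → Bool) (Fin k → ℝ) n) (t : ℕ)
    (x : Fin k → ℕ) : ℕ :=
  Finset.univ.sup fun v : Fin (P.size t) =>
    if ∀ j, parLo P t v j ≤ x j ∧ x j ≤ parHi P t v j then
      (∑ j, parHi P t v j) - ∑ j, x j
    else 0

/-- The total potential `Φ_t` of layer `t` (k-parallel case): the sum of `φ_t(x)`
over `x ∈ {0, 1, …, ⌊n/10⌋}^k`. -/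
noncomputable def PhiPar {k n : ℕ} (P : ROBP (Fin k → Bool) (Fin k → ℝ) n) (t : ℕ) : ℕ :=
  ∑ x ∈ Fintype.piFinset (fun _ : Fin k => Finset.range (n / 10 + 1)), phiPar P t x

/-- The generalized binomial coefficient `C(x, m) = x (x-1) ⋯ (x-m+1) / m!`. -/
noncomputable def genChoose (x : ℝ) (m : ℕ) : ℝ :=
  (∏ i ∈ Finset.range m, (x - (i : ℝ))) / (Nat.factorial m : ℝ)

namespace ROBP

variable {σ Out : Type} {n : ℕ}

/-- The state in layer `t` depends only on the first `t` letters. -/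
lemma state_congr (P : ROBP σ Out n) {x y : ℕ → σ} {t : ℕ} (h : ∀ i < t, x i = y i) :
    P.state x t = P.state y t := by
  induction t with
  | zero => rfl
  | succ t ih =>
    simp only [state]
    rw [ih fun i hi => h i (by omega), h t (by omega)]

lemma state_update (P : ROBP σ Out n) (x : ℕ → σ) (t : ℕ) (l : σ) :
    P.state (Function.update x t l) (t + 1) = P.step t (P.state x t) l := by
  have h : P.state (Function.update x t l) t = P.state x t :=
    P.state_congr fun i hi => Function.update_of_ne (by omega) _ _
  simp only [state, h, Function.update_self]

lemma size_le_width (P : ROBP σ Out n) {t : ℕ} (ht : t ≤ n) : P.size t ≤ P.width :=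
  Finset.le_sup (f := P.size) (Finset.mem_range.2 (by omega))

/-- The minimal number of occurrences of the letter `j` among words leading to the
vertex `v` of layer `t`. -/
noncomputable def minCount {k : ℕ} (P : ROBP (Fin k) Out n) (t : ℕ) (v : Fin (P.size t))
    (j : Fin k) : ℕ :=
  sInf {c | ∃ x : ℕ → Fin k, P.state x t = v ∧ countK x t j = c}

lemma minCount_le {k : ℕ} (P : ROBP (Fin k) Out n) {t : ℕ} {v : Fin (P.size t)}
    {x : ℕ → Fin k} (h : P.state x t = v) (j : Fin k) : P.minCount t v j ≤ countK x t j :=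
  Nat.sInf_le ⟨x, h, rfl⟩

lemma exists_countK_eq_minCount {k : ℕ} (P : ROBP (Fin k) Out n) (t : ℕ) (x : ℕ → Fin k)
    (j : Fin k) :
    ∃ y, P.state y t = P.state x t ∧ countK y t j = P.minCount t (P.state x t) j :=
  Nat.sInf_mem (s := {c | ∃ y : ℕ → Fin k, P.state y t = P.state x t ∧ countK y t j = c})
    ⟨_, x, rfl, rfl⟩

end ROBP

lemma countK_update_succ {k : ℕ} (x : ℕ → Fin k) (t : ℕ) (l j : Fin k) :
    countK (Function.update x t l) (t + 1) j = countK x t j + if l = j then 1 else 0 := by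
  have h : (Finset.range t).filter (fun i => Function.update x t l i = j) =
      (Finset.range t).filter (fun i => x i = j) := by
    refine Finset.filter_congr fun i hi => ?_
    rw [Function.update_of_ne (Finset.mem_range.1 hi).ne]
  unfold countK
  rw [Finset.range_add_one, Finset.filter_insert, Function.update_self, h]
  split_ifs
  · rw [Finset.card_insert_of_notMem (by simp)]
  · rfl

namespace ROBP

variable {Out : Type} {n k m : ℕ}

/-- Reading a letter raises only the minimal count of that letter, and by at most one. -/
lemma minCount_update_le (P : ROBP (Fin k) Out n) (x : ℕ → Fin k) (t : ℕ) (l j : Fin k) :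
    P.minCount (t + 1) (P.state (Function.update x t l) (t + 1)) j ≤
      P.minCount t (P.state x t) j + if l = j then 1 else 0 := by
  obtain ⟨y, hy, hc⟩ := P.exists_countK_eq_minCount t x j
  rw [← hc, ← countK_update_succ]
  exact P.minCount_le (by rw [state_update, state_update, hy]) j

/-- If no vertex before layer `T` has minimal counts exactly `g` on the letters in the image
of `e`, there is a word of length `T` using only these letters and leading to a vertex whose
minimal counts are bounded by `g`. -/
lemma exists_greedy_word [NeZero k] (P : ROBP (Fin k) Out n) (e : Fin m ↪ Fin k)
    (g : Fin m → ℕ) {T : ℕ}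
    (hg : ∀ t < T, ∀ v : Fin (P.size t), ∃ j, P.minCount t v (e j) ≠ g j) :
    ∃ x : ℕ → Fin k, ∑ j, countK x T (e j) = T ∧
      ∀ j, P.minCount T (P.state x T) (e j) ≤ g j := by
  induction T with
  | zero =>
    refine ⟨fun _ => 0, by simp [countK], fun j => ?_⟩
    exact (P.minCount_le rfl _).trans (by simp [countK])
  | succ t ih =>
    obtain ⟨x, hx, hle⟩ := ih fun s hs => hg s (by omega)
    obtain ⟨i, hi⟩ := hg t (by omega) (P.state x t)
    refine ⟨Function.update x t (e i), ?_, fun j => ?_⟩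
    · simp [countK_update_succ, Finset.sum_add_distrib, hx]
    · refine (P.minCount_update_le x t (e i) (e j)).trans ?_
      have hj := hle j
      by_cases hij : i = j
      · subst hij
        simp only [if_true]
        omega
      · simpa [hij] using hj

end ROBP

lemma ComputesApproxCountK.countK_le {k n : ℕ} {Δ : ℝ} {P : ROBP (Fin k) (Fin k → ℝ) n}
    (hP : ComputesApproxCountK k n Δ P) {x y : ℕ → Fin k} (h : P.state x n = P.state y n)
    (j : Fin k) : (countK x n j : ℝ) ≤ countK y n j + 2 * Δ := by
  have h1 := abs_le.1 (hP x j)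
  have h2 := abs_le.1 (hP y j)
  have h3 : P.eval x = P.eval y := by simp only [ROBP.eval, h]
  rw [h3] at h1
  linarith [h1.1, h2.2]

/-- Every low grid point is the vector of minimal counts of some vertex. -/
lemma ComputesApproxCountK.exists_minCount_eq {k n m L : ℕ} [NeZero k] {Δ : ℝ}
    {P : ROBP (Fin k) (Fin k → ℝ) n} (hP : ComputesApproxCountK k n Δ P) (e : Fin m ↪ Fin k)
    (hL : (m : ℝ) * (L + 2 * Δ) < n) (g : Fin m → ℕ) (hg : ∀ j, g j ≤ L) :
    ∃ t < n, ∃ v : Fin (P.size t), ∀ j, P.minCount t v (e j) = g j := by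
  by_contra! hcon
  obtain ⟨x, hx, hle⟩ := P.exists_greedy_word e g hcon
  have hcount : ∀ j, (countK x n (e j) : ℝ) ≤ L + 2 * Δ := by
    intro j
    obtain ⟨y, hy, hc⟩ := P.exists_countK_eq_minCount n x (e j)
    have h1 := hP.countK_le hy.symm (e j)
    have h2 : (countK y n (e j) : ℝ) ≤ L := by
      exact_mod_cast hc.le.trans ((hle j).trans (hg j))
    linarith
  have hsum : (n : ℝ) ≤ m * (L + 2 * Δ) := by
    calc (n : ℝ) = ∑ j, (countK x n (e j) : ℝ) := by exact_mod_cast hx.symm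
      _ ≤ ∑ _j : Fin m, ((L : ℝ) + 2 * Δ) := Finset.sum_le_sum fun j _ => hcount j
      _ = m * (L + 2 * Δ) := by simp [mul_add]
  linarith

lemma ComputesApproxCountK.pow_le_mul_width {k n m L : ℕ} [NeZero k] {Δ : ℝ}
    {P : ROBP (Fin k) (Fin k → ℝ) n} (hP : ComputesApproxCountK k n Δ P) (e : Fin m ↪ Fin k)
    (hL : (m : ℝ) * (L + 2 * Δ) < n) : (L + 1) ^ m ≤ n * P.width := by
  choose t ht v hv using fun g : Fin m → Fin (L + 1) =>
    hP.exists_minCount_eq e hL (fun j => (g j : ℕ)) fun j => Nat.le_of_lt_succ (g j).2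
  let f : (Fin m → Fin (L + 1)) → Fin n × Fin P.width := fun g =>
    (⟨t g, ht g⟩, ⟨v g, lt_of_lt_of_le (v g).isLt (P.size_le_width (ht g).le)⟩)
  have hf : Function.Injective f := by
    intro g g' h
    simp only [f, Prod.mk.injEq, Fin.mk.injEq] at h
    have key : ∀ (s s' : ℕ) (u : Fin (P.size s)) (u' : Fin (P.size s')), s = s' →
        (u : ℕ) = u' → ∀ j, P.minCount s u j = P.minCount s' u' j := by
      rintro s s' u u' rfl hu j
      rw [Fin.ext hu]
    funext j
    apply Fin.ext
    rw [← hv g j, ← hv g' j]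
    exact key _ _ _ _ h.1 h.2 _
  simpa using Fintype.card_le_of_injective f hf

/-- there are absolute constants `c > 0` and `C ≥ 1` such that for all
`k ≥ C` and `n ≥ C·k`, any length-`n` ROBP over `[k]` computing `ApproxCount_k[n, n/k]`
has width `w` with `log₂ w ≥ c · k · log₂(n/k)`. -/
theorem stmt19 :
    ∃ c C : ℝ, 0 < c ∧ 1 ≤ C ∧
      ∀ k n : ℕ, C ≤ (k : ℝ) → C * (k : ℝ) ≤ (n : ℝ) →
        ∀ P : ROBP (Fin k) (Fin k → ℝ) n, P.Reachable →
          ComputesApproxCountK k n ((n : ℝ) / (k : ℝ)) P →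
          Real.logb 2 (P.width : ℝ) ≥ c * (k : ℝ) * Real.logb 2 ((n : ℝ) / (k : ℝ)) := by
  refine ⟨1 / 16, 2 ^ 32, by norm_num, by norm_num, ?_⟩
  intro k n hk hn P _ hP
  have hk0 : (0 : ℝ) < k := by linarith
  have hkn : 0 < k := by exact_mod_cast hk0
  have : NeZero k := ⟨hkn.ne'⟩
  have hn0 : (0 : ℝ) < n := lt_of_lt_of_le (by positivity) hn
  set y : ℝ := (n : ℝ) / k with hy
  have hyC : (2 : ℝ) ^ 32 ≤ y := by rwa [hy, le_div_iff₀ hk0]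
  have hy0 : 0 < y := by linarith
  have hnky : (n : ℝ) = k * y := by rw [hy]; field_simp
  have hm4 : ((k / 4 : ℕ) : ℝ) ≤ k / 4 := by exact_mod_cast Nat.cast_div_le
  have hm8 : (k : ℝ) / 8 ≤ ((k / 4 : ℕ) : ℝ) := by
    have h1 : k < 4 * (k / 4) + 4 := by omega
    have h2 : (k : ℝ) < 4 * ((k / 4 : ℕ) : ℝ) + 4 := by exact_mod_cast h1
    linarith
  have hLy : ((n / k : ℕ) : ℝ) ≤ y := Nat.cast_div_le
  have hyL : y ≤ ((n / k : ℕ) : ℝ) + 1 := by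
    rw [hy, div_le_iff₀ hk0]
    have h1 : n ≤ (n / k + 1) * k := by
      rw [mul_comm]
      exact (Nat.lt_mul_div_succ n hkn).le
    exact_mod_cast h1
  have hL : ((k / 4 : ℕ) : ℝ) * (((n / k : ℕ) : ℝ) + 2 * y) < n := by
    calc ((k / 4 : ℕ) : ℝ) * (((n / k : ℕ) : ℝ) + 2 * y)
        ≤ k / 4 * (y + 2 * y) := by gcongr
      _ < n := by rw [hnky]; nlinarith [mul_pos hk0 hy0]
  have hpow : y ^ (k / 4) ≤ n * P.width := by
    refine (pow_le_pow_left₀ hy0.le hyL _).trans ?_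
    exact_mod_cast hP.pow_le_mul_width (Fin.castLEEmb (Nat.div_le_self k 4)) hL
  have hw0 : (0 : ℝ) < P.width := by
    exact_mod_cast (P.sizePos 0).trans_le (P.size_le_width (Nat.zero_le n))
  have hlog := Real.logb_le_logb_of_le one_lt_two (pow_pos hy0 _) hpow
  rw [Real.logb_pow, Real.logb_mul hn0.ne' hw0.ne', hnky,
    Real.logb_mul hk0.ne' hy0.ne'] at hlog
  have hlogy : 32 ≤ Real.logb 2 y := by
    rw [Real.le_logb_iff_rpow_le one_lt_two hy0]
    exact_mod_cast hyC
  have hlogk : Real.logb 2 k ≤ k := by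
    rw [Real.logb_le_iff_le_rpow one_lt_two hk0, Real.rpow_natCast]
    exact_mod_cast Nat.lt_two_pow_self.le
  have h1 : (k : ℝ) / 8 * Real.logb 2 y ≤ ((k / 4 : ℕ) : ℝ) * Real.logb 2 y := by gcongr
  have h2 : (k : ℝ) * 32 ≤ k * Real.logb 2 y := by gcongr
  have h3 : 32 * Real.logb 2 y ≤ k * Real.logb 2 y := by gcongr; linarith
  linarith
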